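/- Let t, u, d be integers with t and u relatively prime, d > 0, d odd, and d dividing t² + 12·u². Then there exist integers y and z such that either d = y² + 12·z² or d = 3·y² + 4·z². -/

import Mathlib

/-- The form `(a, 2b, c)` is obtained from one of the reduced forms of discriminant `-48`. -/
def RepForm (a b c : ℤ) : Prop :=
  (2 ∣ a ∧ 2 ∣ b ∧ 2 ∣ c) ∨
  (∃ p q r s : ℤ, a = p ^ 2 + 12 * q ^ 2 ∧ b = p * r + 12 * q * s ∧ c = r ^ 2 + 12 * s ^ 2) ∨
  (∃ p q r s : ℤ, a = 3 * p ^ 2 + 4 * q ^ 2 ∧ b = 3 * p * r + 4 * q * s ∧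
    c = 3 * r ^ 2 + 4 * s ^ 2)

theorem RepForm.swap {a b c : ℤ} (h : RepForm a b c) : RepForm c b a := by
  rcases h with ⟨h1, h2, h3⟩ | ⟨p, q, r, s, rfl, rfl, rfl⟩ | ⟨p, q, r, s, rfl, rfl, rfl⟩
  · exact Or.inl ⟨h3, h2, h1⟩
  · exact Or.inr (Or.inl ⟨r, s, p, q, by ring, by ring, by ring⟩)
  · exact Or.inr (Or.inr ⟨r, s, p, q, by ring, by ring, by ring⟩)

theorem RepForm.shift {a b c : ℤ} (k : ℤ) (h : RepForm a b c) :
    RepForm a (b + k * a) (c + 2 * k * b + k ^ 2 * a) := by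
  rcases h with ⟨⟨x, rfl⟩, ⟨y, rfl⟩, ⟨z, rfl⟩⟩ | ⟨p, q, r, s, rfl, rfl, rfl⟩ |
    ⟨p, q, r, s, rfl, rfl, rfl⟩
  · exact Or.inl ⟨⟨x, by ring⟩, ⟨y + k * x, by ring⟩, ⟨z + 2 * k * y + k ^ 2 * x, by ring⟩⟩
  · exact Or.inr (Or.inl ⟨p, q, r + k * p, s + k * q, by ring, by ring, by ring⟩)
  · exact Or.inr (Or.inr ⟨p, q, r + k * p, s + k * q, by ring, by ring, by ring⟩)

theorem repForm_reduced (a b c : ℤ) (ha : 0 < a) (h : a * c = b ^ 2 + 12)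
    (h1 : -a ≤ 2 * b) (h2 : 2 * b ≤ a) (hac : a ≤ c) : RepForm a b c := by
  have hb : 4 * b ^ 2 ≤ a ^ 2 := by nlinarith
  have ha4 : a ≤ 4 := by nlinarith
  have hb1 : -2 ≤ b := by omega
  have hb2 : b ≤ 2 := by omega
  interval_cases a <;> interval_cases b <;> try omega
  · obtain rfl : c = 12 := by omega
    exact Or.inr (Or.inl ⟨1, 0, 0, 1, by norm_num, by norm_num, by norm_num⟩)
  · obtain rfl : c = 6 := by omega
    exact Or.inl (by norm_num)
  · obtain rfl : c = 4 := by omega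
    exact Or.inr (Or.inr ⟨1, 0, 0, 1, by norm_num, by norm_num, by norm_num⟩)
  · obtain rfl : c = 4 := by omega
    exact Or.inl (by norm_num)
  · obtain rfl : c = 4 := by omega
    exact Or.inl (by norm_num)

theorem repForm_all (n : ℕ) : ∀ a b c : ℤ, 0 < a → a.toNat = n → a * c = b ^ 2 + 12 →
    RepForm a b c := by
  induction n using Nat.strong_induction_on with
  | _ n ih =>
    intro a b c ha hn h
    obtain ⟨k, hk1, hk2⟩ : ∃ k : ℤ, -a ≤ 2 * (b + k * a) ∧ 2 * (b + k * a) ≤ a := by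
      refine ⟨-((2 * b + a) / (2 * a)), ?_, ?_⟩
      · have := Int.mul_ediv_add_emod (2 * b + a) (2 * a)
        have := Int.emod_nonneg (2 * b + a) (show 2 * a ≠ 0 by omega)
        nlinarith
      · have := Int.mul_ediv_add_emod (2 * b + a) (2 * a)
        have := Int.emod_lt_of_pos (2 * b + a) (show 0 < 2 * a by omega)
        nlinarith
    have key : RepForm a (b + k * a) (c + 2 * k * b + k ^ 2 * a) := by
      have h' : a * (c + 2 * k * b + k ^ 2 * a) = (b + k * a) ^ 2 + 12 := by
        linear_combination h
      generalize c + 2 * k * b + k ^ 2 * a = c' at *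
      generalize b + k * a = b' at *
      have hc : 0 < c' := by
        by_contra hc
        nlinarith [sq_nonneg b']
      rcases le_or_gt a c' with hac | hac
      · exact repForm_reduced a b' c' ha h' hk1 hk2 hac
      · exact (ih c'.toNat (by omega) c' b' a hc rfl (by linarith)).swap
    have := key.shift (-k)
    convert this using 1 <;> ring

theorem stmt_14 (t u d : ℤ) (hcop : IsCoprime t u) (hd : d > 0)
    (hodd : ¬ (2 ∣ d)) (hdvd : d ∣ t ^ 2 + 12 * u ^ 2) :
    ∃ y z : ℤ, d = y ^ 2 + 12 * z ^ 2 ∨ d = 3 * y ^ 2 + 4 * z ^ 2 := by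
  have hc : IsCoprime u d := by
    refine IsCoprime.of_isCoprime_of_dvd_right ?_ hdvd
    have h2 : IsCoprime u (t ^ 2) := hcop.symm.pow_right
    have := h2.add_mul_left_right (12 * u)
    have e : t ^ 2 + 12 * u ^ 2 = t ^ 2 + u * (12 * u) := by ring
    rw [e]
    exact this
  obtain ⟨v, w, hvw⟩ := hc
  obtain ⟨m, hm⟩ := hdvd
  have hs : d ∣ (t * v) ^ 2 + 12 := by
    refine ⟨v ^ 2 * m + 12 * w * (1 + v * u), ?_⟩
    linear_combination v ^ 2 * hm - 12 * (1 + v * u) * hvw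
  obtain ⟨c, hc⟩ := hs
  rcases repForm_all _ d (t * v) c hd rfl hc.symm with h | ⟨p, q, r, s, h, -⟩ | ⟨p, q, r, s, h, -⟩
  · exact absurd h.1 hodd
  · exact ⟨p, q, Or.inl h⟩
  · exact ⟨p, q, Or.inr h⟩
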